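/- Let η: ℝ → ℝ, m: ℝ → ℝ and v₁, v₂: ℝ → ℝ be continuously differentiable with m v₁' and m v₂' differentiable, set u(x) = (v₁(x₃), v₂(x₃), 0), ρ(x) = η(x₃), μ(x) = m(x₃), and suppose Π: ℝ³ → ℝ is twice continuously differentiable such that the stationary momentum equation Σ_{j=1}^{3} ∂_j(ρ u_i u_j) − Σ_{j=1}^{3} ∂_j(μ(∂_j u_i + ∂_i u_j)) + ∂_i Π = 0 holds on ℝ³ for i = 1,2,3 (with zero external force). Then ∂₃Π ≡ 0, and there exist constants C₁, C₂ ∈ ℝ such that ∂₁Π ≡ C₁, ∂₂Π ≡ C₂, and (m v₁')'(t) = C₁, (m v₂')'(t) = C₂ for all t ∈ ℝ; in particular Π(x) = C₁ x₁ + C₂ x₂ + c for some constant c. -/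

import Mathlib

/-- Partial derivative of a scalar function on ℝ³ in the `i`-th coordinate direction. -/
noncomputable def pd (i : Fin 3) (f : (Fin 3 → ℝ) → ℝ) (x : Fin 3 → ℝ) : ℝ :=
  fderiv ℝ f x (Pi.single i 1)

theorem pd_comp_two (g : ℝ → ℝ) (hg : Differentiable ℝ g) (j : Fin 3) (x : Fin 3 → ℝ) :
    pd j (fun y => g (y 2)) x = if j = 2 then deriv g (x 2) else 0 := by
  have h2 : HasFDerivAt (fun y : Fin 3 → ℝ => y 2)
      (ContinuousLinearMap.proj (R := ℝ) (φ := fun _ : Fin 3 => ℝ) 2) x :=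
    (ContinuousLinearMap.proj (R := ℝ) (φ := fun _ : Fin 3 => ℝ) 2).hasFDerivAt
  have h := (hg (x 2)).hasDerivAt.comp_hasFDerivAt x h2
  have h3 : HasFDerivAt (fun y : Fin 3 → ℝ => g (y 2)) _ x := h
  unfold pd
  rw [h3.fderiv]
  fin_cases j <;> simp

theorem pd_zero_fun (j : Fin 3) (x : Fin 3 → ℝ) : pd j (fun _ => (0 : ℝ)) x = 0 := by
  simp [pd]

theorem fderiv_eq_pd (f : (Fin 3 → ℝ) → ℝ) (x w : Fin 3 → ℝ) :
    fderiv ℝ f x w = w 0 * pd 0 f x + w 1 * pd 1 f x + w 2 * pd 2 f x := by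
  have : w = w 0 • Pi.single 0 1 + w 1 • Pi.single 1 1 + w 2 • Pi.single 2 1 := by
    ext k; fin_cases k <;> simp
  conv_lhs => rw [this]
  simp only [map_add, map_smul, smul_eq_mul, pd]

theorem shift_inv (f : (Fin 3 → ℝ) → ℝ) (hf : Differentiable ℝ f)
    (h : ∀ x, pd 2 f x = 0) (x : Fin 3 → ℝ) (t : ℝ) :
    f (x + t • Pi.single 2 1) = f x := by
  have hd : ∀ s : ℝ, HasDerivAt (fun s : ℝ => f (x + s • Pi.single 2 1)) 0 s := by
    intro s
    have h1 : HasDerivAt (fun s : ℝ => x + s • (Pi.single 2 1 : Fin 3 → ℝ))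
        ((1 : ℝ) • (Pi.single 2 1 : Fin 3 → ℝ)) s :=
      ((hasDerivAt_id s).smul_const _).const_add x
    have h2 := (hf (x + s • Pi.single 2 1)).hasFDerivAt.comp_hasDerivAt s h1
    have h3 := h (x + s • Pi.single 2 1)
    unfold pd at h3
    rw [one_smul, h3] at h2
    exact h2
  have := is_const_of_deriv_eq_zero (fun s => (hd s).differentiableAt)
    (fun s => (hd s).deriv) t 0
  simpa using this

theorem pd_shift_inv (f : (Fin 3 → ℝ) → ℝ) (hf : Differentiable ℝ f)
    (h : ∀ x, pd 2 f x = 0) (i : Fin 3) (x : Fin 3 → ℝ) (t : ℝ) :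
    pd i f (x + t • Pi.single 2 1) = pd i f x := by
  have h1 : (fun y => f (y + t • Pi.single 2 1)) = f := funext fun y => shift_inv f hf h y t
  unfold pd
  rw [← fderiv_comp_add_right, h1]

/-- Classification of the pressure for solutions of symmetry type II in Cartesian
coordinates: if `u(x) = (v₁(x₃), v₂(x₃), 0)`, `ρ(x) = η(x₃)`, `μ(x) = m(x₃)` and a C²
pressure `Π` satisfy the stationary momentum equation with zero force, then `∂₃Π ≡ 0`
and there are constants `C₁, C₂, c` with `∂₁Π ≡ C₁`, `∂₂Π ≡ C₂`, `(m v₁')' ≡ C₁`,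
`(m v₂')' ≡ C₂` and `Π(x) = C₁x₁ + C₂x₂ + c`. -/
theorem pressure_classification_typeII_cartesian
    (η m v₁ v₂ : ℝ → ℝ)
    (hη : ContDiff ℝ 1 η) (hm : ContDiff ℝ 1 m)
    (hv₁ : ContDiff ℝ 1 v₁) (hv₂ : ContDiff ℝ 1 v₂)
    (hd₁ : Differentiable ℝ (fun t => m t * deriv v₁ t))
    (hd₂ : Differentiable ℝ (fun t => m t * deriv v₂ t))
    (u : (Fin 3 → ℝ) → (Fin 3 → ℝ)) (ρ μ press : (Fin 3 → ℝ) → ℝ)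
    (hu : ∀ x, u x = ![v₁ (x 2), v₂ (x 2), 0])
    (hρ : ∀ x, ρ x = η (x 2))
    (hμ : ∀ x, μ x = m (x 2))
    (hpress : ContDiff ℝ 2 press)
    (hmom : ∀ (i : Fin 3) (x : Fin 3 → ℝ),
      (∑ j, pd j (fun y => ρ y * u y i * u y j) x)
        - (∑ j, pd j (fun y =>
            μ y * (pd j (fun z => u z i) y + pd i (fun z => u z j) y)) x)
        + pd i press x = 0) :
    (∀ x, pd 2 press x = 0)
    ∧ ∃ C₁ C₂ c : ℝ,
        (∀ x, pd 0 press x = C₁) ∧ (∀ x, pd 1 press x = C₂)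
        ∧ (∀ t, deriv (fun s => m s * deriv v₁ s) t = C₁)
        ∧ (∀ t, deriv (fun s => m s * deriv v₂ s) t = C₂)
        ∧ (∀ x, press x = C₁ * x 0 + C₂ * x 1 + c) := by
  have hη' := hη.differentiable (by norm_num)
  have hv₁' := hv₁.differentiable (by norm_num)
  have hv₂' := hv₂.differentiable (by norm_num)
  have hu0 : ∀ x, u x 0 = v₁ (x 2) := fun x => by simp [hu]
  have hu1 : ∀ x, u x 1 = v₂ (x 2) := fun x => by simp [hu]
  have hu2 : ∀ x, u x 2 = 0 := fun x => by simp [hu]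
  have c1 : ∀ g : ℝ → ℝ, Differentiable ℝ g → ∀ x,
      pd 0 (fun y => g (y 2)) x = 0 := fun g hg x => by
    rw [pd_comp_two g hg]; simp
  have c2 : ∀ g : ℝ → ℝ, Differentiable ℝ g → ∀ x,
      pd 1 (fun y => g (y 2)) x = 0 := fun g hg x => by
    rw [pd_comp_two g hg]; simp
  have c3 : ∀ g : ℝ → ℝ, Differentiable ℝ g → ∀ x,
      pd 2 (fun y => g (y 2)) x = deriv g (x 2) := fun g hg x => by
    rw [pd_comp_two g hg]; simp
  have H2 : ∀ x, pd 2 press x = 0 := by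
    intro x
    have h := hmom 2 x
    simp only [Fin.sum_univ_three, hu0, hu1, hu2, hρ, hμ, mul_zero, zero_mul, pd_zero_fun,
      c1 v₁ hv₁', c2 v₁ hv₁', c3 v₁ hv₁', c1 v₂ hv₂', c2 v₂ hv₂', c3 v₂ hv₂',
      zero_add, add_zero, c1 _ hd₁, c2 _ hd₂, sub_zero] at h
    exact h
  have H0 : ∀ x, pd 0 press x = deriv (fun s => m s * deriv v₁ s) (x 2) := by
    intro x
    have h := hmom 0 x
    simp only [Fin.sum_univ_three, hu0, hu1, hu2, hρ, hμ, mul_zero, zero_mul, pd_zero_fun,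
      c1 v₁ hv₁', c2 v₁ hv₁', c3 v₁ hv₁', c1 v₂ hv₂', c2 v₂ hv₂', c3 v₂ hv₂',
      zero_add, add_zero, c3 _ hd₁,
      c1 _ ((hη'.fun_mul hv₁').fun_mul hv₁'), c2 _ ((hη'.fun_mul hv₁').fun_mul hv₂')] at h
    linarith
  have H1 : ∀ x, pd 1 press x = deriv (fun s => m s * deriv v₂ s) (x 2) := by
    intro x
    have h := hmom 1 x
    simp only [Fin.sum_univ_three, hu0, hu1, hu2, hρ, hμ, mul_zero, zero_mul, pd_zero_fun,
      c1 v₁ hv₁', c2 v₁ hv₁', c3 v₁ hv₁', c1 v₂ hv₂', c2 v₂ hv₂', c3 v₂ hv₂',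
      zero_add, add_zero, c3 _ hd₂,
      c1 _ ((hη'.fun_mul hv₂').fun_mul hv₁'), c2 _ ((hη'.fun_mul hv₂').fun_mul hv₂')] at h
    linarith
  have hp : Differentiable ℝ press := hpress.differentiable (by norm_num)
  have K0 : ∀ t, deriv (fun s => m s * deriv v₁ s) t = deriv (fun s => m s * deriv v₁ s) 0 := by
    intro t
    have h := pd_shift_inv press hp H2 0 0 t
    rw [H0, H0] at h
    simpa using h
  have K1 : ∀ t, deriv (fun s => m s * deriv v₂ s) t = deriv (fun s => m s * deriv v₂ s) 0 := by
    intro t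
    have h := pd_shift_inv press hp H2 1 0 t
    rw [H1, H1] at h
    simpa using h
  refine ⟨H2, deriv (fun s => m s * deriv v₁ s) 0, deriv (fun s => m s * deriv v₂ s) 0,
    press 0, fun x => (H0 x).trans (K0 _), fun x => (H1 x).trans (K1 _), K0, K1, ?_⟩
  generalize deriv (fun s => m s * deriv v₁ s) 0 = C₁ at *
  generalize deriv (fun s => m s * deriv v₂ s) 0 = C₂ at *
  intro x
  let L : (Fin 3 → ℝ) →L[ℝ] ℝ :=
    C₁ • ContinuousLinearMap.proj (R := ℝ) (φ := fun _ : Fin 3 => ℝ) 0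
      + C₂ • ContinuousLinearMap.proj (R := ℝ) (φ := fun _ : Fin 3 => ℝ) 1
  have hL : ∀ w, L w = C₁ * w 0 + C₂ * w 1 := fun w => by simp [L]
  have hd : ∀ y, HasFDerivAt (fun z => press z - L z) (0 : (Fin 3 → ℝ) →L[ℝ] ℝ) y := by
    intro y
    have h := (hp y).hasFDerivAt.sub L.hasFDerivAt
    have e : fderiv ℝ press y - L = 0 := by
      ext1 w
      rw [ContinuousLinearMap.sub_apply, fderiv_eq_pd, hL, H0, H1, H2, K0, K1]
      simp; ring
    rw [e] at h
    exact h
  have := is_const_of_fderiv_eq_zero (𝕜 := ℝ) (fun y => (hd y).differentiableAt)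
    (fun y => (hd y).fderiv) x 0
  simp only [hL, Pi.zero_apply] at this
  linarith
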